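/- A set E ⊆ ℝ^d is weakly porous if and only if there is a constant C such that for every cube R ⊆ ℝ^d, ∑_{Q ∈ 𝒟₀(R,E)} |Q| ≤ C|R|, where 𝒟₀(R,E) = {Q ∈ 𝒟(R) : Q ∩ E ≠ ∅ and |Q| ≤ |M(R)|}. -/

import Mathlib

open MeasureTheory Metric

/-- A half-open axis-parallel cube in `ℝ^d`: `[a₁, a₁+l) × ⋯ × [a_d, a_d+l)`. -/
structure Cube (d : ℕ) where
  a : Fin d → ℝ
  l : ℝ
  l_pos : 0 < l

/-- The underlying point set of a cube. -/
def Cube.set {d : ℕ} (Q : Cube d) : Set (EuclideanSpace ℝ (Fin d)) :=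
  {x | ∀ i, Q.a i ≤ x i ∧ x i < Q.a i + Q.l}

/-- `Q` is a dyadic subcube of `R`: a member of `𝒟_j(R)` for some `j ≥ 0`. -/
def IsDyadicSubcube {d : ℕ} (R Q : Cube d) : Prop :=
  ∃ j : ℕ, ∃ k : Fin d → ℕ, (∀ i, k i < 2 ^ j) ∧ Q.l = R.l / 2 ^ j ∧
    ∀ i, Q.a i = R.a i + (k i : ℝ) * (R.l / 2 ^ j)

/-- `Q' ∈ ℱ(R,E)`: a maximal dyadic subcube of `R` avoiding `E`, i.e.
`Q' ∩ E = ∅` and its dyadic parent `πQ'` meets `E`. -/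
def IsMaxEmpty {d : ℕ} (R : Cube d) (E : Set (EuclideanSpace ℝ (Fin d))) (Q' : Cube d) : Prop :=
  IsDyadicSubcube R Q' ∧ Q'.set ∩ E = ∅ ∧
    ∃ P : Cube d, IsDyadicSubcube R P ∧ P.l = 2 * Q'.l ∧ Q'.set ⊆ P.set ∧ (P.set ∩ E).Nonempty

/-- `M = M(R)`: a largest dyadic subcube of `R` containing no point of `E`. -/
def IsLargestEmptyDyadic {d : ℕ} (R : Cube d) (E : Set (EuclideanSpace ℝ (Fin d)))
    (M : Cube d) : Prop :=
  IsDyadicSubcube R M ∧ M.set ∩ E = ∅ ∧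
    ∀ Q : Cube d, IsDyadicSubcube R Q → Q.set ∩ E = ∅ → Q.l ≤ M.l

/-- Weak porosity of `E ⊆ ℝ^d`. -/
def WeaklyPorous {d : ℕ} (E : Set (EuclideanSpace ℝ (Fin d))) : Prop :=
  ∃ c δ : ℝ, 0 < c ∧ c < 1 ∧ 0 < δ ∧ δ < 1 ∧
    ∀ R : Cube d, ∃ M : Cube d, IsLargestEmptyDyadic R E M ∧
      ∃ F : Finset (Cube d),
        (↑F : Set (Cube d)).Pairwise (fun Q Q' => Disjoint Q.set Q'.set) ∧
        (∀ Q ∈ F, IsDyadicSubcube R Q ∧ Q.set ∩ E = ∅ ∧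
          ENNReal.ofReal δ * volume M.set ≤ volume Q.set) ∧
        ENNReal.ofReal c * volume R.set ≤ ∑ Q ∈ F, volume Q.set

namespace Cube

variable {d : ℕ}

/-- The subcube of `R` of generation `j` with integer coordinates `k`. -/
noncomputable def sub (R : Cube d) (j : ℕ) (k : Fin d → ℕ) : Cube d where
  a i := R.a i + (k i : ℝ) * (R.l / 2 ^ j)
  l := R.l / 2 ^ j
  l_pos := div_pos R.l_pos (by positivity)

theorem eq_of_a_l {P Q : Cube d} (ha : ∀ i, P.a i = Q.a i) (hl : P.l = Q.l) : P = Q := by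
  cases P; cases Q
  simp only [mk.injEq]
  exact ⟨funext ha, hl⟩

theorem isDyadicSubcube_sub (R : Cube d) (j : ℕ) (k : Fin d → Fin (2 ^ j)) :
    IsDyadicSubcube R (R.sub j (fun i => k i)) :=
  ⟨j, fun i => k i, fun i => (k i).2, rfl, fun _ => rfl⟩

theorem exists_eq_sub {R Q : Cube d} (h : IsDyadicSubcube R Q) :
    ∃ j, ∃ k : Fin d → Fin (2 ^ j), Q = R.sub j (fun i => k i) := by
  obtain ⟨j, k, hk, hl, ha⟩ := h
  exact ⟨j, fun i => ⟨k i, hk i⟩, eq_of_a_l ha hl⟩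

theorem set_subset_of_le {P Q : Cube d} (h₁ : ∀ i, Q.a i ≤ P.a i)
    (h₂ : ∀ i, P.a i + P.l ≤ Q.a i + Q.l) : P.set ⊆ Q.set := fun _ hx i =>
  ⟨(h₁ i).trans (hx i).1, (hx i).2.trans_le (h₂ i)⟩

theorem sub_bounds (R : Cube d) (j : ℕ) (k : Fin d → Fin (2 ^ j)) (i : Fin d) :
    R.a i ≤ (R.sub j (fun i => k i)).a i ∧
      (R.sub j (fun i => k i)).a i + (R.sub j (fun i => k i)).l ≤ R.a i + R.l := by
  have hp : 0 < R.l / 2 ^ j := div_pos R.l_pos (by positivity)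
  have hk : ((k i : ℕ) : ℝ) + 1 ≤ 2 ^ j := by exact_mod_cast (k i).2
  have h := mul_le_mul_of_nonneg_right hk hp.le
  have : (2 : ℝ) ^ j * (R.l / 2 ^ j) = R.l := by field_simp
  simp only [sub]
  constructor
  · have : 0 ≤ ((k i : ℕ) : ℝ) * (R.l / 2 ^ j) := by positivity
    linarith
  · linarith

theorem sub_set_subset (R : Cube d) (j : ℕ) (k : Fin d → Fin (2 ^ j)) :
    (R.sub j (fun i => k i)).set ⊆ R.set :=
  set_subset_of_le (fun i => (R.sub_bounds j k i).1) (fun i => (R.sub_bounds j k i).2)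

theorem set_subset_of_isDyadicSubcube {R Q : Cube d} (h : IsDyadicSubcube R Q) :
    Q.set ⊆ R.set := by
  obtain ⟨j, k, rfl⟩ := exists_eq_sub h
  exact R.sub_set_subset j k

theorem l_le_of_isDyadicSubcube {R Q : Cube d} (h : IsDyadicSubcube R Q) : Q.l ≤ R.l := by
  obtain ⟨j, k, rfl⟩ := exists_eq_sub h
  exact div_le_self R.l_pos.le (one_le_pow₀ (by norm_num))

/-- Composition of two dyadic subdivisions. -/
theorem sub_sub (R : Cube d) (i j : ℕ) (b k : Fin d → ℕ) :
    (R.sub i b).sub j k = R.sub (i + j) (fun t => k t + 2 ^ j * b t) := by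
  refine eq_of_a_l (fun t => ?_) ?_
  · simp only [sub]
    push_cast
    rw [pow_add]
    field_simp
    ring
  · simp only [sub]
    rw [pow_add]
    field_simp

theorem mul_pow_le_and_lt_of_mem {R : Cube d} {i n : ℕ} {k k' : Fin d → ℕ}
    {x : EuclideanSpace ℝ (Fin d)} (hx : x ∈ (R.sub i k).set)
    (hx' : x ∈ (R.sub (i + n) k').set) (t : Fin d) :
    k t * 2 ^ n ≤ k' t ∧ k' t < (k t + 1) * 2 ^ n := by
  have h := hx t
  have h' := hx' t
  simp only [sub] at h h'
  have hp : 0 < R.l / 2 ^ (i + n) := div_pos R.l_pos (by positivity)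
  have e : R.l / 2 ^ i = 2 ^ n * (R.l / 2 ^ (i + n)) := by
    rw [pow_add]; field_simp
  rw [e] at h
  set u := R.l / 2 ^ (i + n)
  constructor
  · have : ((k t : ℝ) * 2 ^ n) * u < (k' t + 1) * u := by nlinarith
    have := lt_of_mul_lt_mul_right this hp.le
    have : k t * 2 ^ n < k' t + 1 := by exact_mod_cast this
    omega
  · have : (k' t : ℝ) * u < ((k t + 1) * 2 ^ n) * u := by nlinarith
    have := lt_of_mul_lt_mul_right this hp.le
    exact_mod_cast this

/-- Two dyadic subcubes with a common point are nested. -/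
theorem sub_set_subset_of_mem {R : Cube d} {i j : ℕ} (hij : i ≤ j) {k k' : Fin d → ℕ}
    {x : EuclideanSpace ℝ (Fin d)} (hx : x ∈ (R.sub i k).set)
    (hx' : x ∈ (R.sub j k').set) : (R.sub j k').set ⊆ (R.sub i k).set := by
  obtain ⟨n, rfl⟩ := Nat.exists_eq_add_of_le hij
  have hp : 0 < R.l / 2 ^ (i + n) := div_pos R.l_pos (by positivity)
  have e : R.l / 2 ^ i = 2 ^ n * (R.l / 2 ^ (i + n)) := by
    rw [pow_add]; field_simp
  refine set_subset_of_le (fun t => ?_) (fun t => ?_)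
  · have h : (k t : ℝ) * 2 ^ n ≤ k' t := by
      exact_mod_cast (mul_pow_le_and_lt_of_mem hx hx' t).1
    simp only [sub]
    rw [e]
    nlinarith
  · have h : (k' t : ℝ) + 1 ≤ (k t + 1) * 2 ^ n := by
      exact_mod_cast (mul_pow_le_and_lt_of_mem hx hx' t).2
    simp only [sub]
    rw [e]
    nlinarith

theorem disjoint_sub {R : Cube d} {j : ℕ} {k k' : Fin d → ℕ} (h : k ≠ k') :
    Disjoint (R.sub j k).set (R.sub j k').set := by
  rw [Set.disjoint_left]
  intro x hx hx'
  refine h (funext fun t => ?_)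
  have := mul_pow_le_and_lt_of_mem (n := 0) hx hx' t
  simp at this
  omega

theorem sub_injective (R : Cube d) (j : ℕ) : Function.Injective (R.sub j) := by
  intro k k' h
  have hp : R.l / 2 ^ j ≠ 0 := (div_pos R.l_pos (by positivity)).ne'
  funext t
  have : (R.sub j k).a t = (R.sub j k').a t := by rw [h]
  simpa [sub, R.l_pos.ne'] using this

theorem volume_set (Q : Cube d) : volume Q.set = ENNReal.ofReal (Q.l ^ d) := by
  have e : Q.set = (fun x : EuclideanSpace ℝ (Fin d) => WithLp.ofLp x) ⁻¹'
      (Set.univ.pi fun i => Set.Ico (Q.a i) (Q.a i + Q.l)) := by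
    ext x
    simp [Cube.set]
  rw [e, (PiLp.volume_preserving_ofLp (Fin d)).measure_preimage
    (MeasurableSet.univ_pi fun i => measurableSet_Ico).nullMeasurableSet, Real.volume_pi_Ico]
  simp [ENNReal.ofReal_pow Q.l_pos.le]

theorem measurableSet_set (Q : Cube d) : MeasurableSet Q.set := by
  have e : Q.set = (fun x : EuclideanSpace ℝ (Fin d) => WithLp.ofLp x) ⁻¹'
      (Set.univ.pi fun i => Set.Ico (Q.a i) (Q.a i + Q.l)) := by
    ext x
    simp [Cube.set]
  rw [e]
  exact (PiLp.volume_preserving_ofLp (Fin d)).measurable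
    (MeasurableSet.univ_pi fun i => measurableSet_Ico)

theorem sum_volume_add_le {R : Cube d} {F G : Finset (Cube d)}
    (hF : (↑F : Set (Cube d)).Pairwise (fun Q Q' => Disjoint Q.set Q'.set))
    (hG : (↑G : Set (Cube d)).Pairwise (fun Q Q' => Disjoint Q.set Q'.set))
    (hFG : ∀ Q ∈ F, ∀ Q' ∈ G, Disjoint Q.set Q'.set)
    (hFR : ∀ Q ∈ F, Q.set ⊆ R.set) (hGR : ∀ Q ∈ G, Q.set ⊆ R.set) :
    ∑ Q ∈ F, volume Q.set + ∑ Q ∈ G, volume Q.set ≤ volume R.set := by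
  rw [← measure_biUnion_finset hF fun Q _ => Q.measurableSet_set,
    ← measure_biUnion_finset hG fun Q _ => Q.measurableSet_set, ← measure_union _
      (Finset.measurableSet_biUnion _ fun Q _ => Q.measurableSet_set)]
  · exact measure_mono (Set.union_subset (Set.iUnion₂_subset hFR) (Set.iUnion₂_subset hGR))
  · simp only [Set.disjoint_iUnion_left, Set.disjoint_iUnion_right]
    exact fun Q' hQ' Q hQ => hFG Q hQ Q' hQ'

/-- A cube contained in `R` contains a dyadic subcube of `R` of comparable side length. -/
theorem exists_isDyadicSubcube_subset {R T : Cube d} (hl : T.l ≤ R.l)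
    (h₁ : ∀ i, R.a i ≤ T.a i) (h₂ : ∀ i, T.a i + T.l ≤ R.a i + R.l) :
    ∃ Q, IsDyadicSubcube R Q ∧ Q.set ⊆ T.set ∧ T.l ≤ 4 * Q.l := by
  obtain ⟨n, hn, hn'⟩ := exists_nat_pow_near ((one_le_div T.l_pos).2 hl) (one_lt_two)
  rw [le_div_iff₀ T.l_pos] at hn
  rw [div_lt_iff₀ T.l_pos] at hn'
  set u := R.l / 2 ^ (n + 2) with hu
  have hu0 : 0 < u := div_pos R.l_pos (by positivity)
  have e : R.l = 2 ^ (n + 2) * u := by rw [hu]; field_simp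
  have h2n : (0 : ℝ) < 2 ^ n := by positivity
  have hTu : T.l ≤ 4 * u := by
    rw [e, pow_add] at hn
    have : 2 ^ n * T.l ≤ 2 ^ n * (4 * u) := by linarith
    exact le_of_mul_le_mul_left this h2n
  have hTu' : 2 * u < T.l := by
    rw [e, pow_add, pow_succ (2 : ℝ) n] at hn'
    have : 2 ^ n * (2 * u) < 2 ^ n * T.l := by linarith
    exact lt_of_mul_lt_mul_left this h2n.le
  have hk : ∀ i, T.a i - R.a i ≤ (⌈(T.a i - R.a i) / u⌉₊ : ℝ) * u ∧
      (⌈(T.a i - R.a i) / u⌉₊ : ℝ) * u < T.a i - R.a i + u := fun i => by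
    have h0 : 0 ≤ (T.a i - R.a i) / u := div_nonneg (sub_nonneg.2 (h₁ i)) hu0.le
    have hc := Nat.le_ceil ((T.a i - R.a i) / u)
    have hc' := Nat.ceil_lt_add_one h0
    constructor
    · rwa [div_le_iff₀ hu0] at hc
    · calc _ < ((T.a i - R.a i) / u + 1) * u := mul_lt_mul_of_pos_right hc' hu0
        _ = _ := by field_simp
  refine ⟨R.sub (n + 2) fun i => ⌈(T.a i - R.a i) / u⌉₊,
    ⟨n + 2, _, fun i => ?_, rfl, fun _ => rfl⟩, set_subset_of_le (fun i => ?_) (fun i => ?_), hTu⟩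
  · have : (⌈(T.a i - R.a i) / u⌉₊ : ℝ) * u < 2 ^ (n + 2) * u := by
      rw [← e]; linarith [hk i, h₂ i]
    exact_mod_cast lt_of_mul_lt_mul_right this hu0.le
  · simp only [sub]
    linarith [hk i]
  · simp only [sub]
    linarith [hk i]

end Cube

section Counting

variable {d : ℕ} {E : Set (EuclideanSpace ℝ (Fin d))}

open Classical in
/-- The number of dyadic subcubes of `R` of generation `j` that meet `E`. -/
noncomputable def hitCount (E : Set (EuclideanSpace ℝ (Fin d))) (R : Cube d) (j : ℕ) : ℝ :=
  ∑ k : Fin d → Fin (2 ^ j), if ((R.sub j (fun i => k i)).set ∩ E).Nonempty then 1 else 0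

open Classical in
theorem hitCount_eq_card (R : Cube d) (j : ℕ) :
    hitCount E R j = (Finset.univ.filter fun k : Fin d → Fin (2 ^ j) =>
      ((R.sub j (fun i => k i)).set ∩ E).Nonempty).card := by
  simp [hitCount]

theorem hitCount_add (R : Cube d) (i j : ℕ) :
    hitCount E R (i + j) =
      ∑ b : Fin d → Fin (2 ^ i), hitCount E (R.sub i (fun t => b t)) j := by
  unfold hitCount
  rw [← Fintype.sum_prod_type']
  refine (Fintype.sum_equiv ((Equiv.arrowProdEquivProdArrow (Fin d) (fun _ => Fin (2 ^ i))
    (fun _ => Fin (2 ^ j))).symm.trans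
    (Equiv.arrowCongr (Equiv.refl (Fin d))
      (finProdFinEquiv.trans (finCongr (pow_add 2 i j).symm)))) _ _ fun x => ?_).symm
  rw [Cube.sub_sub]
  rfl

theorem hitCount_le (R : Cube d) (j : ℕ) : hitCount E R j ≤ (2 ^ j) ^ d := by
  classical
  calc hitCount E R j ≤ ∑ k : Fin d → Fin (2 ^ j), 1 :=
        Finset.sum_le_sum fun k _ => by split_ifs <;> norm_num
    _ = _ := by simp

theorem hitCount_nonneg (R : Cube d) (j : ℕ) : 0 ≤ hitCount E R j :=
  Finset.sum_nonneg fun k _ => by split_ifs <;> norm_num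

theorem hitCount_eq_of_forall {R : Cube d} {j : ℕ}
    (h : ∀ k : Fin d → Fin (2 ^ j), ((R.sub j (fun i => k i)).set ∩ E).Nonempty) :
    hitCount E R j = (2 ^ j) ^ d := by
  simp [hitCount, h]

theorem hitCount_eq_zero {R : Cube d} (h : R.set ∩ E = ∅) (j : ℕ) : hitCount E R j = 0 := by
  refine Finset.sum_eq_zero fun k _ => if_neg ?_
  rw [Set.not_nonempty_iff_eq_empty, ← Set.subset_empty_iff, ← h]
  exact Set.inter_subset_inter_left _ (R.sub_set_subset j k)

/-- If the index `g` of the largest gap is doubling and a fixed proportion of every cube is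
covered by gaps of generation `g + m`, then the proportion of subcubes meeting `E` decays
geometrically. -/
theorem hitCount_le_pow {g : Cube d → ℕ} {D m : ℕ} {r : ℝ} (hr : 0 ≤ r)
    (hg : ∀ P q, q < g P → ∀ k : Fin d → Fin (2 ^ q),
      ((P.sub q (fun i => k i)).set ∩ E).Nonempty)
    (hD : ∀ (P : Cube d) (b : Fin d → Fin (2 ^ 1)), g (P.sub 1 (fun i => b i)) + 1 ≤ g P + D)
    (hm : ∀ R, hitCount E R (g R + m) ≤ r * (2 ^ (g R + m)) ^ d) (s : ℕ) :
    ∀ R j, g R + s * (m + D) ≤ j → hitCount E R j ≤ r ^ s * (2 ^ j) ^ d := by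
  induction s with
  | zero => intro R j _; simpa using hitCount_le R j
  | succ s ih =>
    have key : ∀ q w, D + s * (m + D) ≤ w → ∀ P : Cube d, g P ≤ q + D →
        hitCount E P (q + w) ≤ r ^ s * (2 ^ w) ^ d * hitCount E P q := by
      intro q w hw
      have hall : ∀ (q : ℕ) (P : Cube d), g P ≤ q + D →
          (∀ k : Fin d → Fin (2 ^ q), ((P.sub q (fun i => k i)).set ∩ E).Nonempty) →
          hitCount E P (q + w) ≤ r ^ s * (2 ^ w) ^ d * hitCount E P q := by
        intro q P hP h
        rw [hitCount_eq_of_forall h]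
        refine (ih P (q + w) (by omega)).trans_eq ?_
        rw [pow_add, mul_pow]
        ring
      induction q with
      | zero =>
        intro P hP
        by_cases h : (P.set ∩ E).Nonempty
        · refine hall 0 P hP fun k => ?_
          have : P.sub 0 (fun i => k i) = P := Cube.eq_of_a_l
            (fun i => by simp [Cube.sub]) (by simp [Cube.sub])
          rwa [this]
        · rw [Set.not_nonempty_iff_eq_empty] at h
          simp [hitCount_eq_zero h]
      | succ q ihq =>
        intro P hP
        by_cases h : q + 1 < g P
        · exact hall _ P hP (hg P _ h)
        · have e : q + 1 + w = 1 + (q + w) := by omega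
          rw [e, hitCount_add, add_comm q 1, hitCount_add, Finset.mul_sum]
          refine Finset.sum_le_sum fun b _ => ihq _ ?_
          have := hD P b
          omega
    intro R j hj
    obtain ⟨w, rfl⟩ : ∃ w, j = g R + m + w := ⟨j - (g R + m), by
      have : m ≤ (s + 1) * (m + D) := by nlinarith
      omega⟩
    have hw : D + s * (m + D) ≤ w := by
      have : (s + 1) * (m + D) = s * (m + D) + m + D := by ring
      omega
    calc hitCount E R (g R + m + w)
        ≤ r ^ s * (2 ^ w) ^ d * hitCount E R (g R + m) := key _ w hw R (by omega)
      _ ≤ r ^ s * (2 ^ w) ^ d * (r * (2 ^ (g R + m)) ^ d) := by gcongr; exact hm R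
      _ = _ := by
        rw [pow_add _ (g R + m) w, mul_pow]
        ring

end Counting

section Gaps

variable {d : ℕ} {E : Set (EuclideanSpace ℝ (Fin d))}

theorem mul_l_le_of_volume_le (hd : d ≠ 0) {δ : ℝ} (h₀ : 0 ≤ δ) (h₁ : δ ≤ 1) {M Q : Cube d}
    (h : ENNReal.ofReal δ * volume M.set ≤ volume Q.set) : δ * M.l ≤ Q.l := by
  rw [Cube.volume_set, Cube.volume_set, ← ENNReal.ofReal_mul h₀,
    ENNReal.ofReal_le_ofReal_iff (pow_nonneg Q.l_pos.le d)] at h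
  refine le_of_pow_le_pow_left₀ hd Q.l_pos.le (le_trans ?_ h)
  rw [mul_pow]
  exact mul_le_mul_of_nonneg_right (pow_le_of_le_one h₀ h₁ hd) (pow_nonneg M.l_pos.le d)

/-- The witness that the large gaps of `E` in `R` cover a fixed proportion of `R`. -/
def GapCover (E : Set (EuclideanSpace ℝ (Fin d))) (c δ : ℝ) (R M : Cube d)
    (F : Finset (Cube d)) : Prop :=
  (↑F : Set (Cube d)).Pairwise (fun Q Q' => Disjoint Q.set Q'.set) ∧
    (∀ Q ∈ F, IsDyadicSubcube R Q ∧ Q.set ∩ E = ∅ ∧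
      ENNReal.ofReal δ * volume M.set ≤ volume Q.set) ∧
    ENNReal.ofReal c * volume R.set ≤ ∑ Q ∈ F, volume Q.set

/-- The maximal gap does not shrink much when a cube is slightly reduced. -/
theorem GapCover.mul_l_le (hd : d ≠ 0) {c δ η t : ℝ} {P R M M' : Cube d} {F : Finset (Cube d)}
    (hF : GapCover E c δ R M F) (hM' : IsLargestEmptyDyadic P E M')
    (hM : IsLargestEmptyDyadic R E M) (hc : 0 < c) (hc₁ : c < 1) (hδ₁ : δ < 1) (hη : 0 < η)
    (hηδ : 4 * η ≤ δ) (ht : d * (t + 8 * η) ≤ c / 2)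
    (h₁ : ∀ i, R.a i ≤ P.a i) (h₂ : ∀ i, P.a i + P.l ≤ R.a i + R.l)
    (hl : (1 - t) * R.l ≤ P.l) (ht₀ : 0 ≤ t) : η * M.l ≤ M'.l := by
  obtain ⟨hdisj, hgap, hcov⟩ := hF
  by_contra! hlt
  have hd1 : (1 : ℝ) ≤ d := by exact_mod_cast Nat.one_le_iff_ne_zero.2 hd
  set y := t + 8 * η with hy
  have hy0 : 0 < y := by positivity
  have hy2 : y < 1 / 2 := by nlinarith
  have hMR := Cube.l_le_of_isDyadicSubcube hM.1
  have hR := R.l_pos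
  set s := 4 * η * M.l with hs
  have hs0 : 0 < s := by have := M.l_pos; positivity
  have hsR : s ≤ 4 * η * R.l := by rw [hs]; gcongr
  have hPs : (1 - y) * R.l ≤ P.l - 2 * s := by
    rw [hy]; nlinarith
  have hP' : 0 < P.l - 2 * s := lt_of_lt_of_le (by nlinarith) hPs
  let P' : Cube d := ⟨fun i => P.a i + s, P.l - 2 * s, hP'⟩
  have hP'P : P'.set ⊆ P.set :=
    Cube.set_subset_of_le (fun i => by simp only [P']; linarith)
      (fun i => by simp only [P']; linarith)
  have key : ∀ Q ∈ F, Disjoint Q.set P'.set := by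
    intro Q hQ
    obtain ⟨-, hQE, hQv⟩ := hgap Q hQ
    have hQl := mul_l_le_of_volume_le hd (by linarith) hδ₁.le hQv
    have hsQ : s ≤ Q.l := le_trans (by rw [hs]; have := M.l_pos; gcongr) hQl
    rw [Set.disjoint_left]
    intro x hxQ hxP
    let T : Cube d := ⟨fun i => max (Q.a i) (x i - s), s, hs0⟩
    have hTQ : T.set ⊆ Q.set := by
      refine Cube.set_subset_of_le (fun i => le_max_left _ _) fun i => ?_
      have := hxQ i
      simp only [T]
      rcases max_cases (Q.a i) (x i - s) with h | h <;> linarith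
    obtain ⟨Q', hQ', hQ'T, hQ'l⟩ := Cube.exists_isDyadicSubcube_subset (R := P) (T := T)
      (by simp only [T]; linarith)
      (fun i => by
        have := (hxP i).1
        simp only [P', T] at this ⊢
        exact le_trans (by linarith) (le_max_right _ _))
      (fun i => by
        have := (hxP i).2
        have := (hxQ i).1
        simp only [P', T] at *
        rcases max_cases (Q.a i) (x i - s) with h | h <;> linarith)
    have := hM'.2.2 Q' hQ' (by
      rw [← Set.subset_empty_iff, ← hQE]
      exact Set.inter_subset_inter_left _ (hQ'T.trans hTQ))
    simp only [T] at hQ'l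
    linarith
  have hvol := Cube.sum_volume_add_le (R := R) (F := F) (G := {P'}) hdisj (by simp)
    (by simpa using key) (fun Q hQ => Cube.set_subset_of_isDyadicSubcube (hgap Q hQ).1)
    (by simpa using hP'P.trans (Cube.set_subset_of_le h₁ h₂))
  rw [Finset.sum_singleton] at hvol
  have hfin := (add_le_add_left hcov (volume P'.set)).trans hvol
  rw [Cube.volume_set, Cube.volume_set, ← ENNReal.ofReal_mul hc.le,
    ← ENNReal.ofReal_add (by positivity) (pow_nonneg P'.l_pos.le d),
    ENNReal.ofReal_le_ofReal_iff (by positivity)] at hfin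
  have hpow : (1 - y) ^ d * R.l ^ d ≤ P'.l ^ d := by
    rw [← mul_pow]
    exact pow_le_pow_left₀ (mul_nonneg (by linarith) hR.le) hPs d
  have hbern := one_add_mul_le_pow (a := -y) (by linarith) d
  have hRd : 0 < R.l ^ d := by positivity
  have : (c + (1 - y) ^ d) * R.l ^ d ≤ 1 * R.l ^ d := by linarith
  have := le_of_mul_le_mul_right this hRd
  rw [← sub_eq_add_neg] at hbern
  linarith

/-- A fixed proportion of the subcubes a few generations below the largest gap avoid `E`. -/
theorem GapCover.hitCount_le (hd : d ≠ 0) {c δ : ℝ} {R M : Cube d} {F : Finset (Cube d)}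
    (hF : GapCover E c δ R M F) (hc : 0 < c) (hδ : 0 < δ) (hδ₁ : δ < 1) {g m : ℕ}
    (hg : M.l = R.l / 2 ^ g) (hm : (1 / 2) ^ m ≤ δ) :
    hitCount E R (g + m) ≤ (1 - c) * (2 ^ (g + m)) ^ d := by
  classical
  obtain ⟨hdisj, hgap, hcov⟩ := hF
  have hR := R.l_pos
  let G : Finset (Cube d) := (Finset.univ.filter fun k : Fin d → Fin (2 ^ (g + m)) =>
    ((R.sub (g + m) (fun i => k i)).set ∩ E).Nonempty).image
      fun k => R.sub (g + m) (fun i => k i)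
  have hinj : Function.Injective
      fun k : Fin d → Fin (2 ^ (g + m)) => R.sub (g + m) (fun i => k i) := fun k k' h =>
    funext fun i => Fin.ext (congrFun (R.sub_injective _ h) i)
  have hsum : ∑ Q ∈ G, volume Q.set =
      ENNReal.ofReal (hitCount E R (g + m) * (R.l / 2 ^ (g + m)) ^ d) := by
    rw [Finset.sum_image hinj.injOn]
    simp only [Cube.volume_set]
    rw [ENNReal.ofReal_mul (hitCount_nonneg _ _), hitCount_eq_card, ENNReal.ofReal_natCast,
      ← nsmul_eq_mul, ← Finset.sum_const]
    rfl
  have hvol := Cube.sum_volume_add_le (R := R) (F := F) (G := G) hdisj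
    (by
      intro Q hQ Q' hQ' hne
      simp only [G, Finset.coe_image, Set.mem_image] at hQ hQ'
      obtain ⟨k, -, rfl⟩ := hQ
      obtain ⟨k', -, rfl⟩ := hQ'
      exact Cube.disjoint_sub fun h => hne (by rw [h]))
    (by
      intro Q hQ Q' hQ'
      obtain ⟨k', hk', rfl⟩ := Finset.mem_image.1 hQ'
      obtain ⟨hQR, hQE, hQv⟩ := hgap Q hQ
      have hQl := mul_l_le_of_volume_le hd hδ.le hδ₁.le hQv
      obtain ⟨i, k, rfl⟩ := Cube.exists_eq_sub hQR
      have hi : i ≤ g + m := by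
        by_contra! hi
        have h1 : R.l / 2 ^ i < R.l / 2 ^ (g + m) :=
          div_lt_div_of_pos_left hR (by positivity) (pow_lt_pow_right₀ one_lt_two hi)
        have h2 : R.l / 2 ^ (g + m) = (1 / 2) ^ m * (R.l / 2 ^ g) := by
          rw [pow_add, one_div, inv_pow]; field_simp
        have h3 : (1 / 2) ^ m * (R.l / 2 ^ g) ≤ δ * (R.l / 2 ^ g) := by gcongr
        rw [hg] at hQl
        simp only [Cube.sub] at hQl
        linarith
      rw [Set.disjoint_left]
      intro x hx hx'
      obtain ⟨z, hz, hzE⟩ := (Finset.mem_filter.1 hk').2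
      exact (Set.ext_iff.1 hQE z).1 ⟨Cube.sub_set_subset_of_mem hi hx hx' hz, hzE⟩)
    (fun Q hQ => Cube.set_subset_of_isDyadicSubcube (hgap Q hQ).1)
    (by
      intro Q hQ
      obtain ⟨k, -, rfl⟩ := Finset.mem_image.1 hQ
      exact R.sub_set_subset _ k)
  have hfin := (add_le_add_left hcov _).trans hvol
  have hN := hitCount_nonneg (E := E) R (g + m)
  rw [hsum, Cube.volume_set, ← ENNReal.ofReal_mul hc.le,
    ← ENNReal.ofReal_add (by positivity) (by positivity),
    ENNReal.ofReal_le_ofReal_iff (by positivity), div_pow] at hfin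
  have hRd : 0 < R.l ^ d := by positivity
  have hp : (0 : ℝ) < (2 ^ (g + m)) ^ d := by positivity
  have : hitCount E R (g + m) / (2 ^ (g + m)) ^ d * R.l ^ d ≤ (1 - c) * R.l ^ d := by
    have e : hitCount E R (g + m) / (2 ^ (g + m)) ^ d * R.l ^ d =
      hitCount E R (g + m) * (R.l ^ d / (2 ^ (g + m)) ^ d) := by ring
    rw [e]; linarith
  exact (div_le_iff₀ hp).1 (le_of_mul_le_mul_right this hRd)

end Gaps

section Doubling

variable {d : ℕ} {E : Set (EuclideanSpace ℝ (Fin d))}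

/-- The maximal gap of a weakly porous set is doubling. -/
theorem exists_pow_mul_l_le (hd : d ≠ 0) {c δ : ℝ} (hc : 0 < c) (hc₁ : c < 1) (hδ : 0 < δ)
    (hδ₁ : δ < 1) {M : Cube d → Cube d} {F : Cube d → Finset (Cube d)}
    (hM : ∀ R, IsLargestEmptyDyadic R E (M R)) (hF : ∀ R, GapCover E c δ R (M R) (F R)) :
    ∃ θ : ℝ, 0 < θ ∧ ∀ Q R : Cube d, R.l = 2 * Q.l → (∀ i, R.a i ≤ Q.a i) →
      (∀ i, Q.a i + Q.l ≤ R.a i + R.l) → θ * (M R).l ≤ (M Q).l := by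
  have hd0 : (0 : ℝ) < d := by exact_mod_cast Nat.pos_of_ne_zero hd
  set t := c / (4 * d) with ht
  set η := min (δ / 4) (c / (32 * d)) with hη
  have ht0 : 0 < t := by positivity
  have hη0 : 0 < η := by positivity
  have hη1 : 4 * η ≤ δ := by have := min_le_left (δ / 4) (c / (32 * d)); linarith
  have hη2 : d * (t + 8 * η) ≤ c / 2 := by
    have h := min_le_right (δ / 4) (c / (32 * d))
    calc d * (t + 8 * η) ≤ d * (c / (4 * d) + 8 * (c / (32 * d))) := by gcongr
      _ = c / 2 := by field_simp; ring
  obtain ⟨n, hn⟩ := exists_nat_gt (1 / t)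
  have hn0 : (0 : ℝ) < n := lt_trans (by positivity) hn
  have hnt : 1 < n * t := by rwa [div_lt_iff₀ ht0] at hn
  refine ⟨η ^ n, by positivity, fun Q R hl h₁ h₂ => ?_⟩
  have hQ := Q.l_pos
  let P : ℕ → Cube d := fun i =>
    ⟨fun v => Q.a v + (i / n : ℝ) * (R.a v - Q.a v), Q.l + (i / n : ℝ) * Q.l, by positivity⟩
  have hstep : ∀ i : ℕ, ((i + 1 : ℕ) / n : ℝ) = i / n + 1 / n := fun i => by
    push_cast; ring
  have key : ∀ i, η ^ i * (M (P i)).l ≤ (M (P 0)).l := by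
    intro i
    induction i with
    | zero => simp
    | succ i ih =>
      refine le_trans ?_ ih
      rw [pow_succ, mul_assoc]
      refine mul_le_mul_of_nonneg_left ?_ (by positivity)
      refine (hF (P (i + 1))).mul_l_le hd (hM (P i)) (hM _) hc hc₁ hδ₁ hη0 hη1 hη2
        (fun v => ?_) (fun v => ?_) ?_ ht0.le
      · simp only [P]
        rw [hstep]
        have : 0 ≤ (1 / n : ℝ) * (Q.a v - R.a v) :=
          mul_nonneg (by positivity) (by linarith [h₁ v])
        linarith
      · simp only [P]
        rw [hstep]
        have : 0 ≤ (1 / n : ℝ) * (R.a v + R.l - (Q.a v + Q.l)) :=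
          mul_nonneg (by positivity) (by linarith [h₂ v])
        rw [hl] at this
        linarith
      · simp only [P]
        rw [hstep]
        have hle : (1 / n : ℝ) ≤ t := by
          rw [div_le_iff₀ hn0]; linarith
        have hi : (0 : ℝ) ≤ i / n := by positivity
        have hn1 : (0 : ℝ) ≤ 1 / n := by positivity
        have h1 : (1 - t) * (1 + (i / n + 1 / n : ℝ)) ≤ 1 + i / n := by
          have : 0 ≤ t * (i / n + 1 / n : ℝ) := by positivity
          linarith
        have := mul_le_mul_of_nonneg_right h1 hQ.le
        linarith
  have e0 : P 0 = Q := Cube.eq_of_a_l (by simp [P]) (by simp [P])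
  have e1 : P n = R := Cube.eq_of_a_l
    (fun v => by simp only [P]; rw [div_self hn0.ne']; ring)
    (by simp only [P]; rw [div_self hn0.ne', hl]; ring)
  simpa [e0, e1] using key n

end Doubling

section Sums

open scoped ENNReal

variable {d : ℕ} {E : Set (EuclideanSpace ℝ (Fin d))}

open Classical in
theorem sum_hit_volume (R : Cube d) (j : ℕ) :
    (∑ k : Fin d → Fin (2 ^ j), if ((R.sub j (fun i => k i)).set ∩ E).Nonempty then
      volume (R.sub j (fun i => k i)).set else 0) =
      ENNReal.ofReal (hitCount E R j * (R.l / 2 ^ j) ^ d) := by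
  rw [ENNReal.ofReal_mul (hitCount_nonneg _ _), hitCount_eq_card, ENNReal.ofReal_natCast,
    ← nsmul_eq_mul, ← Finset.sum_const, ← Finset.sum_filter]
  simp only [Cube.volume_set]
  rfl

open Classical in
theorem tsum_sigma_hit_volume (R : Cube d) (g : ℕ) :
    (∑' p : (Σ i : ℕ, (Fin d → Fin (2 ^ (g + i)))),
      if ((R.sub (g + p.1) (fun i => p.2 i)).set ∩ E).Nonempty then
        volume (R.sub (g + p.1) (fun i => p.2 i)).set else 0) =
      ∑' i, ENNReal.ofReal (hitCount E R (g + i) * (R.l / 2 ^ (g + i)) ^ d) := by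
  rw [ENNReal.tsum_sigma']
  exact tsum_congr fun i => by rw [tsum_fintype]; exact sum_hit_volume R (g + i)

theorem tsum_pow_div_lt_top {q : ℝ≥0∞} (hq : q < 1) {N : ℕ} (hN : N ≠ 0) :
    ∑' i : ℕ, q ^ (i / N) < ∞ := by
  have : NeZero N := ⟨hN⟩
  rw [← (Nat.divModEquiv N).symm.tsum_eq, ENNReal.tsum_prod']
  have : ∀ (a : ℕ) (b : Fin N), q ^ ((Nat.divModEquiv N).symm (a, b) / N) = q ^ a := by
    intro a b
    congr 1
    rw [Nat.divModEquiv_symm_apply, add_comm, Nat.add_mul_div_right _ _ (Nat.pos_of_ne_zero hN)]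
    simp
  simp only [this, tsum_fintype, Finset.sum_const, nsmul_eq_mul, ENNReal.tsum_mul_left]
  rw [ENNReal.tsum_geometric]
  refine ENNReal.mul_lt_top (by simp) (ENNReal.inv_lt_top.2 (tsub_pos_of_lt hq))

/-- Geometric decay of the counting function bounds the sum over the small cubes meeting `E`. -/
theorem tsum_volume_le (hd : d ≠ 0) {R M : Cube d} {g N : ℕ} {r : ℝ} (hr : 0 ≤ r)
    (hg : M.l = R.l / 2 ^ g)
    (h : ∀ s j, g + s * N ≤ j → hitCount E R j ≤ r ^ s * (2 ^ j) ^ d) :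
    ∑' Q : {Q : Cube d // IsDyadicSubcube R Q ∧ (Q.set ∩ E).Nonempty ∧
      volume Q.set ≤ volume M.set}, volume Q.1.set ≤
      (∑' i : ℕ, ENNReal.ofReal r ^ (i / N)) * volume R.set := by
  classical
  have hR := R.l_pos
  have hex : ∀ Q : {Q : Cube d // IsDyadicSubcube R Q ∧ (Q.set ∩ E).Nonempty ∧
      volume Q.set ≤ volume M.set}, ∃ p : Σ i : ℕ, (Fin d → Fin (2 ^ (g + i))),
      Q.1 = R.sub (g + p.1) (fun i => p.2 i) := by
    rintro ⟨Q, hQR, -, hQv⟩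
    obtain ⟨j, k, rfl⟩ := Cube.exists_eq_sub hQR
    rw [Cube.volume_set, Cube.volume_set, ENNReal.ofReal_le_ofReal_iff
      (pow_nonneg M.l_pos.le d), hg] at hQv
    have hl : R.l / 2 ^ j ≤ R.l / 2 ^ g := le_of_pow_le_pow_left₀ hd (by positivity) hQv
    have hgj : g ≤ j := by
      by_contra! hj
      exact absurd hl (not_le.2 (div_lt_div_of_pos_left hR (by positivity)
        (pow_lt_pow_right₀ one_lt_two hj)))
    obtain ⟨i, rfl⟩ := Nat.exists_eq_add_of_le hgj
    exact ⟨⟨i, k⟩, rfl⟩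
  choose f hf using hex
  have hinj : Function.Injective f := fun Q Q' hQ => Subtype.ext (by rw [hf Q, hf Q', hQ])
  let G : (Σ i : ℕ, (Fin d → Fin (2 ^ (g + i)))) → ℝ≥0∞ := fun p =>
    if ((R.sub (g + p.1) (fun i => p.2 i)).set ∩ E).Nonempty then
      volume (R.sub (g + p.1) (fun i => p.2 i)).set else 0
  calc _ = ∑' Q, G (f Q) := tsum_congr fun Q => by
        simp only [G]
        rw [← hf Q, if_pos Q.2.2.1]
    _ ≤ ∑' p, G p := ENNReal.tsum_comp_le_tsum_of_injective hinj G
    _ = ∑' i, ENNReal.ofReal (hitCount E R (g + i) * (R.l / 2 ^ (g + i)) ^ d) :=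
        tsum_sigma_hit_volume R g
    _ ≤ ∑' i, ENNReal.ofReal r ^ (i / N) * volume R.set := by
        refine ENNReal.tsum_le_tsum fun i => ?_
        rw [Cube.volume_set, ← ENNReal.ofReal_pow hr, ← ENNReal.ofReal_mul (by positivity)]
        refine ENNReal.ofReal_le_ofReal ?_
        have hi := h (i / N) (g + i) (by have := Nat.div_mul_le_self i N; omega)
        calc _ ≤ r ^ (i / N) * (2 ^ (g + i)) ^ d * (R.l / 2 ^ (g + i)) ^ d := by gcongr
          _ = _ := by rw [div_pow]; field_simp
    _ = _ := ENNReal.tsum_mul_right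

/-- The sum over the small cubes meeting `E` dominates the sum of finitely many generations. -/
theorem sum_generations_le_tsum {R M : Cube d} {g : ℕ} (hg : M.l = R.l / 2 ^ g) (n : ℕ) :
    ∑ i ∈ Finset.range n, ENNReal.ofReal (hitCount E R (g + i) * (R.l / 2 ^ (g + i)) ^ d) ≤
      ∑' Q : {Q : Cube d // IsDyadicSubcube R Q ∧ (Q.set ∩ E).Nonempty ∧
        volume Q.set ≤ volume M.set}, volume Q.1.set := by
  classical
  have hR := R.l_pos
  let S := {p : Σ i : ℕ, (Fin d → Fin (2 ^ (g + i))) //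
    ((R.sub (g + p.1) (fun i => p.2 i)).set ∩ E).Nonempty}
  let f : S → {Q : Cube d // IsDyadicSubcube R Q ∧ (Q.set ∩ E).Nonempty ∧
        volume Q.set ≤ volume M.set} := fun p =>
    ⟨R.sub (g + p.1.1) (fun i => p.1.2 i), R.isDyadicSubcube_sub _ _, p.2, by
      rw [Cube.volume_set, Cube.volume_set, hg]
      refine ENNReal.ofReal_le_ofReal (pow_le_pow_left₀ (Cube.l_pos _).le ?_ d)
      exact div_le_div_of_nonneg_left hR.le (by positivity)
        (pow_le_pow_right₀ one_le_two (Nat.le_add_right _ _))⟩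
  have hinj : Function.Injective f := by
    rintro ⟨⟨i, k⟩, hk⟩ ⟨⟨i', k'⟩, hk'⟩ h
    have h' : R.sub (g + i) (fun t => k t) = R.sub (g + i') (fun t => k' t) :=
      congrArg Subtype.val h
    have hl : R.l / 2 ^ (g + i) = R.l / 2 ^ (g + i') := congrArg Cube.l h'
    have hii : i = i' := by
      have hp : (2 : ℝ) ^ (g + i) = 2 ^ (g + i') := by
        field_simp at hl
        exact hl.symm
      have := pow_right_injective₀ (by norm_num : (0 : ℝ) < 2) (by norm_num) hp
      omega
    subst hii
    have : k = k' := funext fun t => Fin.ext (congrFun (R.sub_injective _ h') t)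
    subst this
    rfl
  calc _ ≤ ∑' i, ENNReal.ofReal (hitCount E R (g + i) * (R.l / 2 ^ (g + i)) ^ d) :=
        ENNReal.sum_le_tsum _
    _ = ∑' p : (Σ i : ℕ, (Fin d → Fin (2 ^ (g + i)))),
          if ((R.sub (g + p.1) (fun i => p.2 i)).set ∩ E).Nonempty then
            volume (R.sub (g + p.1) (fun i => p.2 i)).set else 0 :=
        (tsum_sigma_hit_volume R g).symm
    _ = ∑' p : S, volume (f p).1.set := by
        refine Eq.symm ((tsum_subtype {p : Σ i : ℕ, (Fin d → Fin (2 ^ (g + i))) |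
          ((R.sub (g + p.1) (fun i => p.2 i)).set ∩ E).Nonempty}
          fun p => volume (R.sub (g + p.1) (fun i => p.2 i)).set).trans ?_)
        simp only [Set.indicator_apply, Set.mem_ofPred_eq]
    _ ≤ _ := ENNReal.tsum_comp_le_tsum_of_injective hinj fun Q => volume Q.1.set

end Sums

section Characterization

variable {d : ℕ} {E : Set (EuclideanSpace ℝ (Fin d))}

theorem IsLargestEmptyDyadic.exists_l_eq {R M : Cube d} (h : IsLargestEmptyDyadic R E M) :
    ∃ g : ℕ, M.l = R.l / 2 ^ g := by
  obtain ⟨j, -, -, hl, -⟩ := h.1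
  exact ⟨j, hl⟩

theorem IsLargestEmptyDyadic.inter_nonempty {R M : Cube d} (h : IsLargestEmptyDyadic R E M)
    {g q : ℕ} (hg : M.l = R.l / 2 ^ g) (hq : q < g) (k : Fin d → Fin (2 ^ q)) :
    ((R.sub q (fun i => k i)).set ∩ E).Nonempty := by
  by_contra hne
  have hle := h.2.2 _ (R.isDyadicSubcube_sub q k) (Set.not_nonempty_iff_eq_empty.1 hne)
  rw [hg] at hle
  exact absurd hle (not_le.2 (div_lt_div_of_pos_left R.l_pos (by positivity)
    (pow_lt_pow_right₀ one_lt_two hq)))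

theorem inter_eq_empty_of_dim_zero (hd : d = 0) {Q Q' : Cube d} (h : Q.set ∩ E = ∅) :
    Q'.set ∩ E = ∅ := by
  subst hd
  simpa [Cube.set] using h

theorem WeaklyPorous.exists_tsum_le (h : WeaklyPorous E) :
    ∃ C : ℝ, ∀ R : Cube d, ∃ M : Cube d, IsLargestEmptyDyadic R E M ∧
      ∑' Q : {Q : Cube d // IsDyadicSubcube R Q ∧ (Q.set ∩ E).Nonempty ∧
        volume Q.set ≤ volume M.set}, volume Q.1.set ≤ ENNReal.ofReal C * volume R.set := by
  obtain ⟨c, δ, hc, hc₁, hδ, hδ₁, h⟩ := h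
  choose M hM F hF using h
  change ∀ R, GapCover E c δ R (M R) (F R) at hF
  by_cases hd : d = 0
  · refine ⟨0, fun R => ⟨M R, hM R, ?_⟩⟩
    rw [ENNReal.tsum_eq_zero.2 fun Q => ?_]
    · exact zero_le
    · exact absurd (inter_eq_empty_of_dim_zero hd (hM R).2.1) Q.2.2.1.ne_empty
  obtain ⟨θ, hθ, hdouble⟩ := exists_pow_mul_l_le hd hc hc₁ hδ hδ₁ hM hF
  choose g hg using fun R => (hM R).exists_l_eq
  obtain ⟨D, hD⟩ := exists_pow_lt_of_lt_one hθ (by norm_num : (1 / 2 : ℝ) < 1)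
  obtain ⟨m, hm⟩ := exists_pow_lt_of_lt_one hδ (by norm_num : (1 / 2 : ℝ) < 1)
  have hm0 : m + D ≠ 0 := by
    rintro h0
    have : m = 0 := by omega
    simp only [this, pow_zero] at hm
    linarith
  have hgD : ∀ (P : Cube d) (b : Fin d → Fin (2 ^ 1)),
      g (P.sub 1 (fun i => b i)) + 1 ≤ g P + D := by
    intro P b
    have hP := P.l_pos
    have h1 := hdouble (P.sub 1 (fun i => b i)) P (by simp [Cube.sub]; ring)
      (fun i => (P.sub_bounds 1 b i).1) (fun i => (P.sub_bounds 1 b i).2)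
    rw [hg, hg] at h1
    set g' := g (P.sub 1 (fun i => b i))
    have e1 : (P.sub 1 (fun i => b i)).l / 2 ^ g' = P.l / 2 ^ (g' + 1) := by
      simp only [Cube.sub]; rw [pow_succ]; field_simp; ring
    have e2 : P.l / 2 ^ (g P + D) = (1 / 2) ^ D * (P.l / 2 ^ g P) := by
      rw [pow_add, one_div, inv_pow]; field_simp
    have h2 : (1 / 2) ^ D * (P.l / 2 ^ g P) ≤ θ * (P.l / 2 ^ g P) := by gcongr
    rw [e1] at h1
    by_contra! hlt
    have := div_lt_div_of_pos_left hP (by positivity)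
      (pow_lt_pow_right₀ (one_lt_two (α := ℝ)) hlt)
    linarith
  have hdecay := hitCount_le_pow (E := E) (sub_nonneg.2 hc₁.le)
    (fun P q hq => (hM P).inter_nonempty (hg P) hq) hgD
    (fun R => (hF R).hitCount_le hd hc hδ hδ₁ (hg R) hm.le)
  refine ⟨(∑' i : ℕ, ENNReal.ofReal (1 - c) ^ (i / (m + D))).toReal, fun R => ⟨M R, hM R, ?_⟩⟩
  rw [ENNReal.ofReal_toReal (tsum_pow_div_lt_top (ENNReal.ofReal_lt_one.2 (by linarith)) hm0).ne]
  exact tsum_volume_le hd (sub_nonneg.2 hc₁.le) (hg R) fun s j => hdecay s R j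

theorem exists_gapCover_of_hitCount_le {R M : Cube d} {g i n : ℕ} (hg : M.l = R.l / 2 ^ g)
    (hin : i ≤ n)
    (hhit : hitCount E R (g + i) * (R.l / 2 ^ (g + i)) ^ d ≤ 1 / 2 * R.l ^ d) :
    ∃ F, GapCover E (1 / 2) (((1 / 2) ^ n) ^ d / 2) R M F := by
  classical
  have hR := R.l_pos
  have hinj : Function.Injective
      fun k : Fin d → Fin (2 ^ (g + i)) => R.sub (g + i) (fun t => k t) := fun k k' h =>
    funext fun t => Fin.ext (congrFun (R.sub_injective _ h) t)
  refine ⟨(Finset.univ.filter fun k : Fin d → Fin (2 ^ (g + i)) =>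
    ¬ ((R.sub (g + i) (fun t => k t)).set ∩ E).Nonempty).image
      fun k => R.sub (g + i) (fun t => k t), ?_, ?_, ?_⟩
  · intro Q hQ Q' hQ' hne
    simp only [Finset.coe_image, Set.mem_image] at hQ hQ'
    obtain ⟨k, -, rfl⟩ := hQ
    obtain ⟨k', -, rfl⟩ := hQ'
    exact Cube.disjoint_sub fun h => hne (by rw [h])
  · intro Q hQ
    obtain ⟨k, hk, rfl⟩ := Finset.mem_image.1 hQ
    refine ⟨R.isDyadicSubcube_sub _ k,
      Set.not_nonempty_iff_eq_empty.1 (Finset.mem_filter.1 hk).2, ?_⟩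
    rw [Cube.volume_set, Cube.volume_set, ← ENNReal.ofReal_mul (by positivity)]
    refine ENNReal.ofReal_le_ofReal ?_
    have hpos : 0 ≤ ((1 / 2 : ℝ) ^ n) ^ d * M.l ^ d := by have := M.l_pos; positivity
    calc ((1 / 2 : ℝ) ^ n) ^ d / 2 * M.l ^ d ≤ ((1 / 2) ^ n) ^ d * M.l ^ d := by linarith
      _ = ((1 / 2) ^ n * (R.l / 2 ^ g)) ^ d := by rw [← mul_pow, hg]
      _ ≤ ((1 / 2) ^ i * (R.l / 2 ^ g)) ^ d := by
        have := pow_le_pow_of_le_one (by norm_num : (0 : ℝ) ≤ 1 / 2) (by norm_num) hin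
        gcongr
      _ = (R.l / 2 ^ (g + i)) ^ d := by
        rw [pow_add, one_div, inv_pow]; congr 1; field_simp
  · have hcard : ((Finset.univ.filter fun k : Fin d → Fin (2 ^ (g + i)) =>
        ¬ ((R.sub (g + i) (fun t => k t)).set ∩ E).Nonempty).card : ℝ) =
        (2 ^ (g + i)) ^ d - hitCount E R (g + i) := by
      rw [hitCount_eq_card, eq_sub_iff_add_eq, add_comm]
      norm_cast
      rw [Finset.card_filter_add_card_filter_not]
      simp
    rw [Finset.sum_image hinj.injOn]
    simp only [Cube.volume_set]
    have hconst : ∀ k : Fin d → Fin (2 ^ (g + i)),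
        (R.sub (g + i) (fun t => k t)).l = R.l / 2 ^ (g + i) := fun _ => rfl
    simp only [hconst, Finset.sum_const, nsmul_eq_mul]
    rw [← ENNReal.ofReal_natCast, ← ENNReal.ofReal_mul (by positivity),
      ← ENNReal.ofReal_mul (by positivity), hcard]
    refine ENNReal.ofReal_le_ofReal ?_
    have e : (2 ^ (g + i) : ℝ) ^ d * (R.l / 2 ^ (g + i)) ^ d = R.l ^ d := by
      rw [← mul_pow]; congr 1; field_simp
    rw [sub_mul, e]
    linarith

theorem weaklyPorous_of_tsum_le {C : ℝ}
    (h : ∀ R : Cube d, ∃ M : Cube d, IsLargestEmptyDyadic R E M ∧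
      ∑' Q : {Q : Cube d // IsDyadicSubcube R Q ∧ (Q.set ∩ E).Nonempty ∧
        volume Q.set ≤ volume M.set}, volume Q.1.set ≤ ENNReal.ofReal C * volume R.set) :
    WeaklyPorous E := by
  obtain ⟨n, hn⟩ := exists_nat_gt (2 * max C 0)
  have hC := le_max_right C 0
  have hn0 : 0 < n := by
    have : (0 : ℝ) < n := by linarith
    exact_mod_cast this
  have hδ : ((1 / 2 : ℝ) ^ n) ^ d ≤ 1 :=
    pow_le_one₀ (by positivity) (pow_le_one₀ (by norm_num) (by norm_num))
  refine ⟨1 / 2, ((1 / 2) ^ n) ^ d / 2, by norm_num, by norm_num, by positivity, by linarith,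
    fun R => ?_⟩
  obtain ⟨M, hM, hsum⟩ := h R
  have hR := R.l_pos
  obtain ⟨g, hg⟩ := hM.exists_l_eq
  have hnn : ∀ i, 0 ≤ hitCount E R (g + i) * (R.l / 2 ^ (g + i)) ^ d := fun i =>
    mul_nonneg (hitCount_nonneg _ _) (by positivity)
  have hle : ENNReal.ofReal (∑ i ∈ Finset.range n,
      hitCount E R (g + i) * (R.l / 2 ^ (g + i)) ^ d) ≤ ENNReal.ofReal (max C 0 * R.l ^ d) := by
    rw [ENNReal.ofReal_sum_of_nonneg fun i _ => hnn i, ENNReal.ofReal_mul hC, ← Cube.volume_set]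
    refine (sum_generations_le_tsum hg n).trans (hsum.trans ?_)
    gcongr
    exact le_max_left _ _
  rw [ENNReal.ofReal_le_ofReal_iff (by positivity)] at hle
  obtain ⟨i, hi, hhit⟩ := Finset.exists_le_of_sum_le
    (g := fun _ => 1 / 2 * R.l ^ d) (Finset.nonempty_range_iff.2 hn0.ne') (hle.trans (by
      rw [Finset.sum_const, Finset.card_range, nsmul_eq_mul, ← mul_assoc]
      gcongr
      linarith))
  exact ⟨M, hM, exists_gapCover_of_hitCount_le hg (Finset.mem_range.1 hi).le hhit⟩

end Characterization

/-- E is weakly porous iff ∑_{Q ∈ 𝒟₀(R,E)} |Q| ≤ C|R| for all cubes R. -/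
theorem stmt16 {d : ℕ} (E : Set (EuclideanSpace ℝ (Fin d))) :
    WeaklyPorous E ↔
      ∃ C : ℝ, ∀ R : Cube d, ∃ M : Cube d, IsLargestEmptyDyadic R E M ∧
        ∑' Q : {Q : Cube d // IsDyadicSubcube R Q ∧ (Q.set ∩ E).Nonempty ∧
            volume Q.set ≤ volume M.set}, volume Q.1.set
          ≤ ENNReal.ofReal C * volume R.set := by
  exact ⟨WeaklyPorous.exists_tsum_le, fun ⟨_, h⟩ => weaklyPorous_of_tsum_le h⟩
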